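/- arXiv:math/0007050 — 2 statements merged into one kernel-verified Lean document; each statement's English description precedes it below -/
import Mathlib

section
/- Fix ε ∈ ℝ² with ‖ε‖ = 1 and fix c > 0. There exists K > 0 such that for every k ∈ ℝ² with ‖k‖ ≥ K, |⟨k,ε⟩| ≥ c·‖k‖ and k × ε ≠ 0, there exists δ > 0 such that for every real t with 0 < |t| < δ there exists α₀ with 0 < α₀ < 1 such that the sectional curvature C(α, k, k+t·ε) = ρ²(α, k, k+t·ε)·B̃(α², k, k+t·ε) is strictly positive for all α > α₀. -/
noncomputable section

/-- Squared Euclidean norm of a vector in ℝ². -/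
def nsq (k : ℝ × ℝ) : ℝ := k.1 ^ 2 + k.2 ^ 2

/-- A_x(k) = ‖k‖²·(1 + x·‖k‖²). -/
def A (x : ℝ) (k : ℝ × ℝ) : ℝ := nsq k * (1 + x * nsq k)

/-- A^α(k) = A_{α²}(k). -/
def Aa (α : ℝ) (k : ℝ × ℝ) : ℝ := A (α ^ 2) k

/-- Cross product k × l = k₁l₂ − k₂l₁. -/
def cross (k l : ℝ × ℝ) : ℝ := k.1 * l.2 - k.2 * l.1

/-- Euclidean inner product ⟨k,l⟩ = k₁l₁ + k₂l₂. -/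
def inner2 (k l : ℝ × ℝ) : ℝ := k.1 * l.1 + k.2 * l.2

/-- The curvature bracket B̃(x,k,l). -/
def Bbr (x : ℝ) (k l : ℝ × ℝ) : ℝ :=
  A x (k + l) * A x (k - l) *
      (4 * A x k + 4 * A x l - 3 * A x (k + l) - 3 * A x (k - l)) +
    (A x k - A x l) ^ 2 * (A x (k + l) + A x (k - l))

/-- ρ²(α,k,l) = S·(k×l)²/(36·A^α(k+l)·A^α(k−l)), with S = 4π². -/
def rhoSq (α : ℝ) (k l : ℝ × ℝ) : ℝ :=
  4 * Real.pi ^ 2 * cross k l ^ 2 / (36 * Aa α (k + l) * Aa α (k - l))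

/-- Sectional curvature C(α,k,l) = ρ²(α,k,l)·B̃(α²,k,l). -/
def C (α : ℝ) (k l : ℝ × ℝ) : ℝ := rhoSq α k l * Bbr (α ^ 2) k l

/-- Taylor coefficients at x = 0 of x ↦ B̃(x,k,l). -/
def bcoef (i : ℕ) (k l : ℝ × ℝ) : ℝ :=
  (1 / (Nat.factorial i : ℝ)) * iteratedDeriv i (fun x => Bbr x k l) 0

theorem nsq_mul_nsq (k l : ℝ × ℝ) : nsq k * nsq l = inner2 k l ^ 2 + cross k l ^ 2 := by
  unfold nsq inner2 cross; ring

theorem nsq_add_smul (k ε : ℝ × ℝ) (hε : nsq ε = 1) (t : ℝ) :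
    nsq (k + t • ε) = nsq k + 2 * t * inner2 k ε + t ^ 2 := by
  have h : nsq (k + t • ε) = nsq k + 2 * t * inner2 k ε + t ^ 2 * nsq ε := by
    simp only [nsq, inner2, Prod.fst_add, Prod.snd_add, Prod.smul_fst, Prod.smul_snd,
      smul_eq_mul]
    ring
  rw [h, hε, mul_one]

theorem nsq_add_add_smul (k ε : ℝ × ℝ) (hε : nsq ε = 1) (t : ℝ) :
    nsq (k + (k + t • ε)) = (2 * inner2 k ε + t) ^ 2 + 4 * cross k ε ^ 2 := by
  have h : nsq (k + (k + t • ε)) = 4 * nsq k + 4 * t * inner2 k ε + t ^ 2 * nsq ε := by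
    simp only [nsq, inner2, Prod.fst_add, Prod.snd_add, Prod.smul_fst, Prod.smul_snd,
      smul_eq_mul]
    ring
  have h' := nsq_mul_nsq k ε
  rw [hε] at h h'
  linear_combination h + 4 * h'

theorem nsq_sub_add_smul (k ε : ℝ × ℝ) (hε : nsq ε = 1) (t : ℝ) :
    nsq (k - (k + t • ε)) = t ^ 2 := by
  have h : nsq (k - (k + t • ε)) = t ^ 2 * nsq ε := by
    simp only [nsq, Prod.fst_add, Prod.snd_add, Prod.smul_fst, Prod.smul_snd,
      Prod.fst_sub, Prod.snd_sub, smul_eq_mul]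
    ring
  rw [h, hε, mul_one]

theorem cross_add_smul (k ε : ℝ × ℝ) (t : ℝ) : cross k (k + t • ε) = t * cross k ε := by
  simp only [cross, Prod.fst_add, Prod.snd_add, Prod.smul_fst, Prod.smul_snd, smul_eq_mul]
  ring

theorem nsq_nonneg (k : ℝ × ℝ) : 0 ≤ nsq k := by unfold nsq; positivity

theorem A_pos {x : ℝ} {k : ℝ × ℝ} (hx : 0 ≤ x) (hk : 0 < nsq k) : 0 < A x k := by
  unfold A; positivity

theorem A_nonneg {x : ℝ} (hx : 0 ≤ x) (k : ℝ × ℝ) : 0 ≤ A x k := by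
  have := nsq_nonneg k
  unfold A; positivity

theorem sq_bounds_of_abs_le {s t : ℝ} (h : |t| ≤ |s|) :
    s ^ 2 ≤ (2 * s + t) ^ 2 ∧ (2 * s + t) ^ 2 ≤ 9 * s ^ 2 := by
  have h1 : t ^ 2 ≤ s ^ 2 := sq_le_sq.2 h
  have h2 : |s * t| ≤ s ^ 2 := by
    rw [abs_mul, ← sq_abs s, sq]
    exact mul_le_mul_of_nonneg_left h (abs_nonneg s)
  obtain ⟨h3, h4⟩ := abs_le.1 h2
  constructor
  · rcases le_total 0 s with hs | hs
    · rw [abs_of_nonneg hs, abs_le] at h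
      nlinarith
    · rw [abs_of_nonpos hs, abs_le] at h
      nlinarith
  · nlinarith

theorem bracket_factor_pos {x t u N M a b Q : ℝ} (hx : 1 / 4 < x) (ht : t ≠ 0)
    (ht1 : t ^ 2 ≤ 1) (hu : 2500 ≤ u ^ 2) (hN : 2500 ≤ N) (hM : 0 ≤ M) (ha : 0 ≤ a)
    (hb : 0 ≤ b) (hQ0 : 0 ≤ Q) (hQ : Q ≤ 117 * x * N ^ 2) :
    0 < t ^ 2 * (1 + x * t ^ 2) * (4 * a + 4 * b - 3 * Q - 3 * (t ^ 2 * (1 + x * t ^ 2)))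
      + (t * u * (1 + x * (N + M))) ^ 2 := by
  have hx0 : 0 < x := by linarith
  have hN0 : 0 < N := by linarith
  have ht2 : 0 < t ^ 2 := by positivity
  have hR0 : 0 ≤ t ^ 2 * (1 + x * t ^ 2) := by positivity
  have h1 : 1 + x * t ^ 2 ≤ 5 * x := by nlinarith
  have hR : t ^ 2 * (1 + x * t ^ 2) ≤ x * N ^ 2 := by
    have hN2 : 5 ≤ N ^ 2 := by nlinarith
    calc t ^ 2 * (1 + x * t ^ 2) ≤ 1 * (5 * x) := by gcongr
      _ ≤ x * N ^ 2 := by nlinarith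
  have hU : (1 + x * t ^ 2) * (3 * Q + 3 * (t ^ 2 * (1 + x * t ^ 2)))
      ≤ 5 * x * (354 * (x * N ^ 2)) :=
    mul_le_mul h1 (by linarith) (by positivity) (by positivity)
  have hL : 2500 * (x * N) ^ 2 ≤ u ^ 2 * (1 + x * (N + M)) ^ 2 := by
    have : 0 ≤ x * M := by positivity
    gcongr
    linarith
  have hpos : 0 < x ^ 2 * N ^ 2 := by positivity
  have hW : 0 ≤ (1 + x * t ^ 2) * (4 * a + 4 * b) := by positivity
  have hfin : 0 < (1 + x * t ^ 2) * (4 * a + 4 * b)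
      - (1 + x * t ^ 2) * (3 * Q + 3 * (t ^ 2 * (1 + x * t ^ 2)))
      + u ^ 2 * (1 + x * (N + M)) ^ 2 := by
    linarith only [hW, hU, hL, hpos]
  calc 0 < _ := mul_pos ht2 hfin
    _ = _ := by ring

/-- The bracket is positive once `⟨k, ε⟩` is large, uniformly for `x` bounded away from `0`. -/
theorem Bbr_add_smul_pos {k ε : ℝ × ℝ} (hε : nsq ε = 1) (hs : 50 ≤ |inner2 k ε|) {t : ℝ}
    (ht : t ≠ 0) (ht1 : |t| < 1) {x : ℝ} (hx : 1 / 4 < x) : 0 < Bbr x k (k + t • ε) := by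
  have hx0 : 0 < x := by linarith
  obtain ⟨hlow, hup⟩ := sq_bounds_of_abs_le (by linarith : |t| ≤ |inner2 k ε|)
  have hP := nsq_add_add_smul k ε hε t
  have hR := nsq_sub_add_smul k ε hε t
  have hM := nsq_add_smul k ε hε t
  have hN : nsq k = inner2 k ε ^ 2 + cross k ε ^ 2 := by
    rw [← nsq_mul_nsq, hε, mul_one]
  have hM0 := nsq_nonneg (k + t • ε)
  have hAk := A_nonneg hx0.le k
  have hAl := A_nonneg hx0.le (k + t • ε)
  have hs2 : 2500 ≤ inner2 k ε ^ 2 := by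
    rw [← sq_abs]; nlinarith
  have hP0 : 0 < nsq (k + (k + t • ε)) := by
    rw [hP]; nlinarith [sq_nonneg (cross k ε)]
  have hP9 : nsq (k + (k + t • ε)) ≤ 9 * nsq k := by
    rw [hP, hN]; nlinarith [sq_nonneg (cross k ε)]
  have hQ := A_pos hx0.le hP0
  have ht21 : t ^ 2 ≤ 1 := by rw [sq_le_one_iff_abs_le_one]; exact ht1.le
  have hN1 : 2500 ≤ nsq k := by rw [hN]; nlinarith [sq_nonneg (cross k ε)]
  have hD : A x k - A x (k + t • ε)
      = -(t * (2 * inner2 k ε + t)) * (1 + x * (nsq k + nsq (k + t • ε))) := by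
    unfold A
    linear_combination (-1 - x * (nsq k + nsq (k + t • ε))) * hM
  have hRA : A x (k - (k + t • ε)) = t ^ 2 * (1 + x * t ^ 2) := by unfold A; rw [hR]
  have hQ9 : A x (k + (k + t • ε)) ≤ 117 * x * nsq k ^ 2 := by
    unfold A
    calc _ ≤ 9 * nsq k * (1 + x * (9 * nsq k)) := by gcongr
      _ ≤ 117 * x * nsq k ^ 2 := by nlinarith [mul_pos hx0 (by linarith : 0 < nsq k)]
  have hkey : 0 < A x (k - (k + t • ε)) * (4 * A x k + 4 * A x (k + t • ε)
      - 3 * A x (k + (k + t • ε)) - 3 * A x (k - (k + t • ε)))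
      + (A x k - A x (k + t • ε)) ^ 2 := by
    rw [hD, hRA, neg_mul, neg_sq]
    exact bracket_factor_pos hx ht ht21 (hs2.trans hlow) hN1 hM0 hAk hAl hQ.le hQ9
  have h3 : 0 ≤ A x (k - (k + t • ε)) := A_nonneg hx0.le _
  have h4 := mul_nonneg (sq_nonneg (A x k - A x (k + t • ε))) h3
  calc 0 < _ := add_pos_of_pos_of_nonneg (mul_pos hQ hkey) h4
    _ = _ := by unfold Bbr; ring

theorem rhoSq_add_smul_pos {k ε : ℝ × ℝ} (hε : nsq ε = 1) (hk : cross k ε ≠ 0) {t : ℝ}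
    (ht : t ≠ 0) (α : ℝ) : 0 < rhoSq α k (k + t • ε) := by
  have h1 : 0 < Aa α (k + (k + t • ε)) :=
    A_pos (sq_nonneg α) (by rw [nsq_add_add_smul k ε hε]; positivity)
  have h2 : 0 < Aa α (k - (k + t • ε)) :=
    A_pos (sq_nonneg α) (by rw [nsq_sub_add_smul k ε hε]; positivity)
  unfold rhoSq
  rw [cross_add_smul]
  positivity

/-- for ε a unit vector and c > 0 there is K > 0 such that for all k with
‖k‖ ≥ K, |⟨k,ε⟩| ≥ c·‖k‖ and k × ε ≠ 0, for all sufficiently small nonzero t there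
is 0 < α₀ < 1 such that C(α, k, k + t·ε) > 0 for all α > α₀. -/
theorem stmt1 (ε : ℝ × ℝ) (hε : Real.sqrt (nsq ε) = 1) (c : ℝ) (hc : 0 < c) :
    ∃ K > 0, ∀ k : ℝ × ℝ, Real.sqrt (nsq k) ≥ K →
      |inner2 k ε| ≥ c * Real.sqrt (nsq k) → cross k ε ≠ 0 →
      ∃ δ > 0, ∀ t : ℝ, 0 < |t| → |t| < δ →
        ∃ α₀ : ℝ, 0 < α₀ ∧ α₀ < 1 ∧ ∀ α : ℝ, α > α₀ → 0 < C α k (k + t • ε) := by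
  have hε1 : nsq ε = 1 := Real.sqrt_eq_one.1 hε
  refine ⟨50 / c, by positivity, fun k hK hs hk => ⟨1, one_pos, fun t ht ht1 =>
    ⟨1 / 2, by norm_num, by norm_num, fun α hα => ?_⟩⟩⟩
  have ht0 : t ≠ 0 := abs_pos.1 ht
  have hs50 : 50 ≤ |inner2 k ε| :=
    calc (50 : ℝ) = c * (50 / c) := by field_simp
      _ ≤ c * Real.sqrt (nsq k) := by gcongr
      _ ≤ |inner2 k ε| := hs
  exact mul_pos (rhoSq_add_smul_pos hε1 hk ht0 α)
    (Bbr_add_smul_pos hε1 hs50 ht0 ht1 (by nlinarith))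
end
end

section
/- Let k, ε ∈ ℝ² with k ≠ 0 and ⟨k,ε⟩ ≠ 0. Then there exists δ > 0 such that b₃(k, k + t·ε) > 0 for every real t with 0 < |t| < δ; i.e., for l sufficiently close to k in the direction ε, the coefficient of α⁶ in the curvature bracket is strictly positive. -/
noncomputable section

/-- The third derivative of a real cubic. -/
lemma iteratedDeriv_three_cubic (a b c d x : ℝ) :
    iteratedDeriv 3 (fun y : ℝ => a + b * y + c * y ^ 2 + d * y ^ 3) x = 6 * d := by
  have h₁ : deriv (fun y : ℝ => a + b * y + c * y ^ 2 + d * y ^ 3) =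
      fun y => b + 2 * c * y + 3 * d * y ^ 2 := by
    funext y
    have h := ((((hasDerivAt_id y).const_mul b).const_add a).add
      (((hasDerivAt_id y).pow 2).const_mul c)).add (((hasDerivAt_id y).pow 3).const_mul d)
    refine (h.congr_deriv ?_).deriv
    simp
    ring
  have h₂ : deriv (fun y : ℝ => b + 2 * c * y + 3 * d * y ^ 2) =
      fun y => 2 * c + 6 * d * y := by
    funext y
    have h := (((hasDerivAt_id y).const_mul (2 * c)).const_add b).add
      (((hasDerivAt_id y).pow 2).const_mul (3 * d))
    refine (h.congr_deriv ?_).deriv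
    simp
    ring
  have h₃ : deriv (fun y : ℝ => 2 * c + 6 * d * y) x = 6 * d := by
    have h := ((hasDerivAt_id x).const_mul (6 * d)).const_add (2 * c)
    exact (h.congr_deriv (mul_one _)).deriv
  rw [iteratedDeriv_succ', iteratedDeriv_succ', iteratedDeriv_one, h₁, h₂, h₃]

/-- The top coefficient of the curvature bracket is the same bracket with `A` replaced by its
leading coefficient `nsq ^ 2`. -/
lemma bcoef_three (k l : ℝ × ℝ) :
    bcoef 3 k l =
      nsq (k + l) ^ 2 * nsq (k - l) ^ 2 *
          (4 * nsq k ^ 2 + 4 * nsq l ^ 2 - 3 * nsq (k + l) ^ 2 - 3 * nsq (k - l) ^ 2) +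
        (nsq k ^ 2 - nsq l ^ 2) ^ 2 * (nsq (k + l) ^ 2 + nsq (k - l) ^ 2) := by
  have h : ∀ p q r s : ℝ,
      (fun x : ℝ => p * (1 + x * p) * (q * (1 + x * q)) *
          (4 * (r * (1 + x * r)) + 4 * (s * (1 + x * s)) - 3 * (p * (1 + x * p)) -
            3 * (q * (1 + x * q))) +
        (r * (1 + x * r) - s * (1 + x * s)) ^ 2 * (p * (1 + x * p) + q * (1 + x * q))) =
      fun x => (p * q * (4 * r + 4 * s - 3 * p - 3 * q) + (r - s) ^ 2 * (p + q)) +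
        (p * q * (4 * r ^ 2 + 4 * s ^ 2 - 3 * p ^ 2 - 3 * q ^ 2) +
          p * q * (p + q) * (4 * r + 4 * s - 3 * p - 3 * q) +
          (r - s) ^ 2 * (p ^ 2 + q ^ 2) + 2 * (r - s) * (r ^ 2 - s ^ 2) * (p + q)) * x +
        (p * q * (p + q) * (4 * r ^ 2 + 4 * s ^ 2 - 3 * p ^ 2 - 3 * q ^ 2) +
          p ^ 2 * q ^ 2 * (4 * r + 4 * s - 3 * p - 3 * q) +
          2 * (r - s) * (r ^ 2 - s ^ 2) * (p ^ 2 + q ^ 2) +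
          (r ^ 2 - s ^ 2) ^ 2 * (p + q)) * x ^ 2 +
        (p ^ 2 * q ^ 2 * (4 * r ^ 2 + 4 * s ^ 2 - 3 * p ^ 2 - 3 * q ^ 2) +
          (r ^ 2 - s ^ 2) ^ 2 * (p ^ 2 + q ^ 2)) * x ^ 3 := by
    intro p q r s
    funext x
    ring
  simp only [bcoef, Bbr, A]
  rw [h, iteratedDeriv_three_cubic]
  norm_num [Nat.factorial]
  ring

lemma nsq_pos {k : ℝ × ℝ} (hk : k ≠ 0) : 0 < nsq k := by
  have h : 0 ≤ nsq k := add_nonneg (sq_nonneg _) (sq_nonneg _)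
  refine h.lt_of_ne fun h₀ => hk ?_
  unfold nsq at h₀
  exact Prod.ext (by simp; nlinarith [sq_nonneg k.1, sq_nonneg k.2])
    (by simp; nlinarith [sq_nonneg k.1, sq_nonneg k.2])

/-- The top coefficient along the line `k + t • ε` is divisible by `t ^ 2`. -/
lemma bcoef_three_add_smul (k ε : ℝ × ℝ) (t : ℝ) :
    bcoef 3 k (k + t • ε) = t ^ 2 *
      (nsq (k + (k + t • ε)) ^ 2 * (t ^ 2 * nsq ε ^ 2) *
          (4 * nsq k ^ 2 + 4 * nsq (k + t • ε) ^ 2 - 3 * nsq (k + (k + t • ε)) ^ 2 -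
            3 * (t ^ 2 * nsq ε) ^ 2) +
        ((2 * inner2 k ε + t * nsq ε) * (nsq k + nsq (k + t • ε))) ^ 2 *
          (nsq (k + (k + t • ε)) ^ 2 + (t ^ 2 * nsq ε) ^ 2)) := by
  have hsub : nsq (k - (k + t • ε)) = t ^ 2 * nsq ε := by
    simp [nsq]
    ring
  have hdiff : nsq k ^ 2 - nsq (k + t • ε) ^ 2 =
      -(t * ((2 * inner2 k ε + t * nsq ε) * (nsq k + nsq (k + t • ε)))) := by
    simp [nsq, inner2]
    ring
  rw [bcoef_three, hsub, hdiff]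
  ring

/-- for k ≠ 0 with ⟨k,ε⟩ ≠ 0, the top coefficient b₃(k, k+t·ε)
is strictly positive for all sufficiently small nonzero t. -/
theorem stmt14 (k ε : ℝ × ℝ) (hk : k ≠ 0) (hke : inner2 k ε ≠ 0) :
    ∃ δ > 0, ∀ t : ℝ, 0 < |t| → |t| < δ → 0 < bcoef 3 k (k + t • ε) := by
  have hcont : Continuous fun t : ℝ =>
      nsq (k + (k + t • ε)) ^ 2 * (t ^ 2 * nsq ε ^ 2) *
          (4 * nsq k ^ 2 + 4 * nsq (k + t • ε) ^ 2 - 3 * nsq (k + (k + t • ε)) ^ 2 -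
            3 * (t ^ 2 * nsq ε) ^ 2) +
        ((2 * inner2 k ε + t * nsq ε) * (nsq k + nsq (k + t • ε))) ^ 2 *
          (nsq (k + (k + t • ε)) ^ 2 + (t ^ 2 * nsq ε) ^ 2) := by
    unfold nsq
    fun_prop
  have hN := nsq_pos hk
  have hdouble : nsq (k + k) = 4 * nsq k := by
    simp [nsq]
    ring
  have hev := (hcont.tendsto 0).eventually_const_lt (u := 0) (by
    simp only [zero_smul, add_zero, hdouble]
    norm_num
    positivity)
  obtain ⟨δ, hδ, h⟩ := Metric.eventually_nhds_iff.mp hev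
  refine ⟨δ, hδ, fun t ht htδ => ?_⟩
  rw [bcoef_three_add_smul]
  exact mul_pos (sq_pos_of_ne_zero (abs_pos.mp ht)) (h (by simpa using htδ))
end
end
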